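/- arXiv:1907.12230 — 2 statements merged into one kernel-verified Lean document; each statement's English description precedes it below -/
import Mathlib

section
/- Let u, v : ℝ² → ℝ be twice continuously differentiable functions satisfying the Cauchy–Riemann relations u_x = v_y and u_y = −v_x on ℝ², and let σ : ℝ → ℝ be continuously differentiable. Define the vector field w : ℝ³ → ℝ³ by w(x,y,z) = cos(σ(z))·(v_x(x,y), v_y(x,y), 0) + sin(σ(z))·(u_x(x,y), u_y(x,y), 0), i.e. w = cos(σ(z))∇v + sin(σ(z))∇u. Then div w = 0 and curl w = σ'(z)·w on ℝ³; that is, every pair of harmonic conjugate functions in the (x,y)-plane together with an arbitrary C¹ function of z generates a solenoidal Beltrami field with proportionality coefficient σ'(z). -/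
noncomputable section

abbrev R3 : Type := Fin 3 → ℝ

/-- Partial derivative of a scalar field in the `i`-th coordinate direction. -/
def pd (i : Fin 3) (f : R3 → ℝ) (x : R3) : ℝ := fderiv ℝ f x (Pi.single i 1)

/-- Curl of a vector field on ℝ³. -/
def vcurl (v : R3 → R3) (x : R3) : R3 :=
  ![pd 1 (fun y => v y 2) x - pd 2 (fun y => v y 1) x,
    pd 2 (fun y => v y 0) x - pd 0 (fun y => v y 2) x,
    pd 0 (fun y => v y 1) x - pd 1 (fun y => v y 0) x]

/-- Divergence of a vector field on ℝ³. -/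
def vdiv (v : R3 → R3) (x : R3) : ℝ :=
  pd 0 (fun y => v y 0) x + pd 1 (fun y => v y 1) x + pd 2 (fun y => v y 2) x

/-- Componentwise directional derivative `(ξ·∇)v`. -/
def dirDeriv (ξ v : R3 → R3) (x : R3) : R3 :=
  fun j => ∑ i : Fin 3, ξ x i * pd i (fun y => v y j) x

/-- Lie derivative of a vector field: `L_ξ v = (ξ·∇)v − (v·∇)ξ`. -/
def lieD (ξ v : R3 → R3) : R3 → R3 :=
  fun x => dirDeriv ξ v x - dirDeriv v ξ x

/-- Gradient of a scalar field on ℝ³. -/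
def grad3 (f : R3 → ℝ) (x : R3) : R3 := fun i => pd i f x

/-- Partial derivative of a function of two real variables in the first variable. -/
def pdfst (f : ℝ × ℝ → ℝ) (p : ℝ × ℝ) : ℝ := fderiv ℝ f p (1, 0)

/-- Partial derivative of a function of two real variables in the second variable. -/
def pdsnd (f : ℝ × ℝ → ℝ) (p : ℝ × ℝ) : ℝ := fderiv ℝ f p (0, 1)


lemma pd_combo (A B : ℝ × ℝ → ℝ) (σ : ℝ → ℝ) (hA : Differentiable ℝ A)
    (hB : Differentiable ℝ B) (hσ : Differentiable ℝ σ) (q : R3) (i : Fin 3) :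
    pd i (fun y => Real.cos (σ (y 2)) * A (y 0, y 1) + Real.sin (σ (y 2)) * B (y 0, y 1)) q
      = Real.cos (σ (q 2)) * fderiv ℝ A (q 0, q 1)
          ((Pi.single i 1 : R3) 0, (Pi.single i 1 : R3) 1)
        + Real.sin (σ (q 2)) * fderiv ℝ B (q 0, q 1)
          ((Pi.single i 1 : R3) 0, (Pi.single i 1 : R3) 1)
        + deriv σ (q 2) * (Pi.single i 1 : R3) 2 *
          (Real.cos (σ (q 2)) * B (q 0, q 1) - Real.sin (σ (q 2)) * A (q 0, q 1)) := by
  have hp : ∀ j : Fin 3, HasFDerivAt (fun y : R3 => y j)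
      (ContinuousLinearMap.proj (R := ℝ) (φ := fun _ : Fin 3 => ℝ) j) q :=
    fun j => hasFDerivAt_apply j q
  have h2 := (hσ (q 2)).hasDerivAt.comp_hasFDerivAt q (hp 2)
  have h01 := (hp 0).prodMk (hp 1)
  have hA' := HasFDerivAt.comp q (hA (q 0, q 1)).hasFDerivAt h01
  have hB' := HasFDerivAt.comp q (hB (q 0, q 1)).hasFDerivAt h01
  have h := (h2.cos.mul hA').add (h2.sin.mul hB')
  have e := h.fderiv
  unfold pd
  refine (congrArg (fun L => L (Pi.single i 1)) e).trans ?_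
  simp
  ring

lemma diff_fderiv_apply (f : ℝ × ℝ → ℝ) (hf : ContDiff ℝ 2 f) (e : ℝ × ℝ) :
    Differentiable ℝ (fun p => fderiv ℝ f p e) := by
  have h : ContDiff ℝ 1 (fderiv ℝ f) := hf.fderiv_right (by norm_num)
  exact (h.differentiable (by norm_num)).clm_apply (differentiable_const e)

lemma pd_symm (f : ℝ × ℝ → ℝ) (hf : ContDiff ℝ 2 f) (p : ℝ × ℝ) :
    fderiv ℝ (pdsnd f) p (1, 0) = fderiv ℝ (pdfst f) p (0, 1) := by
  have h : ContDiff ℝ 1 (fderiv ℝ f) := hf.fderiv_right (by norm_num)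
  have hd : DifferentiableAt ℝ (fderiv ℝ f) p := h.differentiable (by norm_num) p
  have key : ∀ a b : ℝ × ℝ,
      fderiv ℝ (fun p => fderiv ℝ f p a) p b = fderiv ℝ (fderiv ℝ f) p b a := by
    intro a b
    rw [fderiv_clm_apply hd (differentiableAt_const a)]
    simp
  have hs : IsSymmSndFDerivAt ℝ f p :=
    hf.contDiffAt.isSymmSndFDerivAt (by simp)
  exact (key _ _).trans ((hs _ _).trans (key _ _).symm)

/-- harmonic conjugate functions `u, v` in the `(x,y)`-plane together
with an arbitrary C¹ function `σ` of `z` generate the solenoidal Beltrami field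
`w = cos(σ(z))∇v + sin(σ(z))∇u` with proportionality coefficient `σ'(z)`. -/
theorem harmonic_conjugates_generate_beltrami
    (u v : ℝ × ℝ → ℝ) (σ : ℝ → ℝ)
    (hu : ContDiff ℝ 2 u) (hv : ContDiff ℝ 2 v) (hσ : ContDiff ℝ 1 σ)
    (hCR1 : ∀ p : ℝ × ℝ, pdfst u p = pdsnd v p)
    (hCR2 : ∀ p : ℝ × ℝ, pdsnd u p = -pdfst v p) :
    let w : R3 → R3 := fun q =>
      Real.cos (σ (q 2)) • ![pdfst v (q 0, q 1), pdsnd v (q 0, q 1), 0]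
      + Real.sin (σ (q 2)) • ![pdfst u (q 0, q 1), pdsnd u (q 0, q 1), 0]
    ∀ q : R3, vdiv w q = 0 ∧ vcurl w q = deriv σ (q 2) • w q := by
  intro w q
  have hA : Differentiable ℝ (pdfst v) := diff_fderiv_apply v hv _
  have hB : Differentiable ℝ (pdsnd v) := diff_fderiv_apply v hv _
  have hσ' : Differentiable ℝ σ := hσ.differentiable (by norm_num)
  have eu1 : pdfst u = pdsnd v := funext hCR1
  have eu2 : pdsnd u = -pdfst v := funext hCR2
  have hw0 : (fun y => w y 0) = fun y : R3 => Real.cos (σ (y 2)) * pdfst v (y 0, y 1)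
      + Real.sin (σ (y 2)) * pdsnd v (y 0, y 1) := by
    funext y; simp [w, eu1]
  have hw1 : (fun y => w y 1) = fun y : R3 => Real.cos (σ (y 2)) * pdsnd v (y 0, y 1)
      + Real.sin (σ (y 2)) * (-pdfst v) (y 0, y 1) := by
    funext y; simp [w, eu2]
  have hw2 : (fun y => w y 2) = fun _ : R3 => (0 : ℝ) := by
    funext y; simp [w]
  have s1 := pd_symm v hv (q 0, q 1)
  have s2 := pd_symm u hu (q 0, q 1)
  rw [eu1, eu2, fderiv_neg, neg_apply] at s2
  have z : ∀ i, pd i (fun _ : R3 => (0 : ℝ)) q = 0 := by intro i; simp [pd]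
  have p0 := pd_combo _ _ σ hA hB hσ' q
  have p1 := pd_combo _ _ σ hB hA.neg hσ' q
  have z00 : ((0 : ℝ), (0 : ℝ)) = 0 := rfl
  constructor
  · unfold vdiv
    rw [hw0, hw1, hw2, z, p0, p1]
    simp [fderiv_neg]
    linear_combination Real.sin (σ (q 2)) * s1 - Real.cos (σ (q 2)) * s2
  · unfold vcurl
    rw [hw0, hw1, hw2, z, z, p0, p0, p1, p1]
    funext i
    fin_cases i
    · simp [fderiv_neg, z00, w, eu1]
      ring
    · simp [fderiv_neg, z00, w, eu2]
      left; ring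
    · simp [fderiv_neg, w]
      linear_combination Real.cos (σ (q 2)) * s1 + Real.sin (σ (q 2)) * s2
end
end

section
/- Define w : ℝ³ → ℝ³ by w(x,y,z) = (x + e^{−z}, −y, 1), which equals ∇((x²−y²)/2 + z) + e^{−z}∇x, and define χ(x,y,z) = e^{−z}(x + e^{−z}/2). Then on all of ℝ³: div w = 0, w × (curl w) = ∇χ, and ∇χ(x,y,z) = (e^{−z}, 0, −e^{−z}(x + e^{−z})) ≠ 0 at every point; thus w is a smooth magnetofluidostatic field with everywhere non-vanishing pressure gradient. -/
noncomputable section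

theorem pd_of_hasFDerivAt {f : R3 → ℝ} {f' : R3 →L[ℝ] ℝ} {x : R3} (h : HasFDerivAt f f' x)
    (i : Fin 3) : pd i f x = f' (Pi.single i 1) := by
  rw [pd, h.fderiv]

/-- the field `w = (x + e⁻ᶻ, −y, 1)` is a smooth magnetofluidostatic
field on all of ℝ³ with pressure field `χ = e⁻ᶻ(x + e⁻ᶻ/2)` and everywhere
non-vanishing pressure gradient `∇χ = (e⁻ᶻ, 0, −e⁻ᶻ(x + e⁻ᶻ))`. -/
theorem explicit_mfs_exp_negz :
    let w : R3 → R3 := fun p => ![p 0 + Real.exp (-(p 2)), -(p 1), 1]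
    let χ : R3 → ℝ := fun p =>
      Real.exp (-(p 2)) * (p 0 + Real.exp (-(p 2)) / 2)
    ∀ p : R3,
      vdiv w p = 0
      ∧ crossProduct (w p) (vcurl w p) = grad3 χ p
      ∧ grad3 χ p = ![Real.exp (-(p 2)), 0,
          -(Real.exp (-(p 2))) * (p 0 + Real.exp (-(p 2)))]
      ∧ grad3 χ p ≠ 0 := by
  intro w χ p
  have hp : ∀ i : Fin 3, HasFDerivAt (fun q : R3 => q i)
      (ContinuousLinearMap.proj (R := ℝ) (φ := fun _ : Fin 3 => ℝ) i) p :=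
    fun i => hasFDerivAt_apply i p
  have he := (hp 2).neg.exp
  have h0 : ∀ i, pd i (fun y => w y 0) p = _ :=
    pd_of_hasFDerivAt (f := fun y => w y 0) ((hp 0).add he)
  have h1 : ∀ i, pd i (fun y => w y 1) p = _ :=
    pd_of_hasFDerivAt (f := fun y => w y 1) (hp 1).neg
  have h2 : ∀ i, pd i (fun y => w y 2) p = _ :=
    pd_of_hasFDerivAt (f := fun y => w y 2) (hasFDerivAt_const (1 : ℝ) p)
  have hχ : ∀ i, pd i χ p = _ :=
    pd_of_hasFDerivAt (f := χ) (he.mul ((hp 0).add (he.mul_const (2⁻¹ : ℝ))))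
  have hg : grad3 χ p = ![Real.exp (-(p 2)), 0,
          -(Real.exp (-(p 2))) * (p 0 + Real.exp (-(p 2)))] := by
    funext i
    rw [grad3, hχ]
    fin_cases i <;> simp
    ring
  refine ⟨?_, ?_, hg, ?_⟩
  · rw [vdiv, h0, h1, h2]
    simp
  · rw [hg, vcurl]
    simp only [h0, h1, h2]
    funext i
    fin_cases i <;> simp [w, cross_apply]
    ring
  · rw [hg]
    intro h
    have := congrFun h 0
    simp at this
end
end
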